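/- Let P be a polytope in ℝⁿ whose graph contains a complete subgraph on p ≥ 3 vertices, i.e., there are p distinct vertices of P such that for every pair u ≠ v among them, the segment conv{u, v} is a 1-dimensional face of P. Then the minimal depth m of P satisfies m ≥ ⌈log₂ p⌉; equivalently, P ∉ Δₙ(⌈log₂ p⌉ − 1). -/

import Mathlib

open Pointwise

noncomputable section

/-- A polytope in `ℝⁿ`: the convex hull of a nonempty finite set of points. -/
def IsPolytope (n : ℕ) (P : Set (Fin n → ℝ)) : Prop :=
  ∃ s : Finset (Fin n → ℝ), s.Nonempty ∧ P = convexHull ℝ ↑s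

/-- `PolyDepth n m` is the set `Δₙ(m)` of neural network polytopes with `m` hidden layers:
`Δₙ(0)` consists of the one-point polytopes, and `Δₙ(m)` consists of the Minkowski sums
`Σᵢ conv(Pᵢ ∪ Qᵢ)` with `Pᵢ, Qᵢ ∈ Δₙ(m-1)`. -/
def PolyDepth (n : ℕ) : ℕ → Set (Set (Fin n → ℝ))
  | 0 => {P | ∃ a, P = {a}}
  | m + 1 => {P | ∃ (k : ℕ) (Q R : Fin (k + 1) → Set (Fin n → ℝ)),
      (∀ i, Q i ∈ PolyDepth n m ∧ R i ∈ PolyDepth n m) ∧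
      P = ∑ i, convexHull ℝ (Q i ∪ R i)}

/-- `P` has minimal depth `m`: `P ∈ Δₙ(m)` and either `m = 0` or `P ∉ Δₙ(m-1)`. -/
def PolyMinDepth (n : ℕ) (P : Set (Fin n → ℝ)) (m : ℕ) : Prop :=
  P ∈ PolyDepth n m ∧ (m = 0 ∨ P ∉ PolyDepth n (m - 1))

/-- A nonempty face of `P`: either `P` itself or the set of maximizers over `P`
of a linear functional `x ↦ c·x`. -/
def IsFace (n : ℕ) (P F : Set (Fin n → ℝ)) : Prop :=
  F = P ∨ ∃ c : Fin n → ℝ, F = {x ∈ P | ∀ y ∈ P, ∑ i, c i * y i ≤ ∑ i, c i * x i}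

/-- `P` is indecomposable: in every decomposition of `P` as a Minkowski sum of polytopes,
each summand is positively homothetic to `P` or a single point. -/
def Indecomposable (n : ℕ) (P : Set (Fin n → ℝ)) : Prop :=
  ∀ (k : ℕ) (Q : Fin (k + 1) → Set (Fin n → ℝ)),
    (∀ i, IsPolytope n (Q i)) → P = ∑ i, Q i →
    ∀ i, (∃ (lam : ℝ) (w : Fin n → ℝ), 0 < lam ∧ Q i = (fun x => lam • x + w) '' P) ∨
      ∃ a, Q i = {a}

lemma sum_sub_add_mem_sum {E ι : Type*} [AddCommGroup E] [Fintype ι] {S : ι → Set E}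
    {g : ι → E} (hg : ∀ i, g i ∈ S i) {i : ι} {x : E} (hx : x ∈ S i) :
    ∑ j, g j - g i + x ∈ ∑ j, S j := by
  classical
  rw [Set.mem_fintype_sum]
  refine ⟨Function.update g i x, fun j => ?_, ?_⟩
  · rcases eq_or_ne j i with rfl | h
    · simpa using hx
    · simpa [h] using hg j
  · rw [Finset.sum_update_of_mem (Finset.mem_univ i),
      ← Finset.sum_sdiff (Finset.subset_univ {i})]
    simp [add_comm]

section Clique

variable {E : Type*} [AddCommGroup E] [Module ℝ E]

/-- The set of maximizers over `P` of the linear functional `f`. -/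
def maximizers (P : Set E) (f : E →ₗ[ℝ] ℝ) : Set E := {x ∈ P | ∀ y ∈ P, f y ≤ f x}

/-- The points of `s` are pairwise joined by edges of `P`. -/
def IsEdgeClique (P : Set E) (s : Finset E) : Prop :=
  ∀ u ∈ s, ∀ v ∈ s, u ≠ v → ∃ f : E →ₗ[ℝ] ℝ, maximizers P f = segment ℝ u v

lemma IsEdgeClique.subset {P : Set E} {s : Finset E} (hs : IsEdgeClique P s) (h : 1 < s.card) :
    ↑s ⊆ P := by
  intro u hu
  obtain ⟨v, hv, hvu⟩ := Finset.exists_mem_ne h u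
  obtain ⟨f, hf⟩ := hs u hu v hv hvu.symm
  exact (hf.symm.subset (left_mem_segment ℝ u v)).1

/-- An edge clique contains no three collinear points. -/
lemma IsEdgeClique.notMem_segment {P : Set E} {s : Finset E} (hs : IsEdgeClique P s) {u v w : E}
    (hu : u ∈ s) (hv : v ∈ s) (hw : w ∈ s) (huw : u ≠ w) (hvw : v ≠ w) :
    w ∉ segment ℝ u v := by
  intro hmem
  obtain ⟨f, hf⟩ := hs u hu w hw huw
  have huf := hf.symm.subset (left_mem_segment ℝ u w)
  have hwf := hf.symm.subset (right_mem_segment ℝ u w)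
  have hvP : v ∈ P := hs.subset (Finset.one_lt_card.2 ⟨u, hu, w, hw, huw⟩) hv
  have hvf : v ∈ maximizers P f := by
    refine ⟨hvP, fun y hy => (huf.2 y hy).trans ?_⟩
    obtain ⟨a, b, ha, hb, hab, rfl⟩ := hmem
    have hb0 : 0 < b := by
      refine hb.lt_of_ne fun h => huw ?_
      subst h
      obtain rfl : a = 1 := by linarith
      simp
    have h1 := hwf.2 u huf.1
    simp only [map_add, map_smul, smul_eq_mul] at h1
    obtain rfl : a = 1 - b := by linarith
    nlinarith
  rw [hf, mem_segment_iff_wbtw] at hvf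
  rw [mem_segment_iff_wbtw] at hmem
  exact hvw ((wbtw_swap_right_iff ℝ u).1 ⟨hvf, hmem⟩)

lemma IsEdgeClique.mono_of_convex {P Q : Set E} {s t : Finset E} (hs : IsEdgeClique P s)
    (hQ : Convex ℝ Q) (hQP : Q ⊆ P) (hts : t ⊆ s) (htQ : ↑t ⊆ Q) : IsEdgeClique Q t := by
  intro u hu v hv huv
  obtain ⟨f, hf⟩ := hs u (hts hu) v (hts hv) huv
  refine ⟨f, Set.Subset.antisymm ?_ ?_⟩
  · rintro x ⟨hx, hmax⟩
    rw [← hf]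
    exact ⟨hQP hx, fun y hy =>
      ((hf.symm.subset (left_mem_segment ℝ u v)).2 y hy).trans (hmax u (htQ hu))⟩
  · intro x hx
    exact ⟨hQ.segment_subset (htQ hu) (htQ hv) hx,
      fun y hy => (hf.symm.subset hx).2 y (hQP hy)⟩

lemma IsEdgeClique.subset_of_convexHull {A : Set E} {s : Finset E}
    (hs : IsEdgeClique (convexHull ℝ A) s) (h : 1 < s.card) : ↑s ⊆ A := by
  intro u hu
  obtain ⟨v, hv, hvu⟩ := Finset.exists_mem_ne h u
  obtain ⟨f, hf⟩ := hs u hu v hv hvu.symm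
  have huf := hf.symm.subset (left_mem_segment ℝ u v)
  refine extremePoints_convexHull_subset (𝕜 := ℝ) ⟨huf.1, ?_⟩
  rintro x hx y hy ⟨a, b, ha, hb, hab, rfl⟩
  have hfx := huf.2 x hx
  have hfy := huf.2 y hy
  simp only [map_add, map_smul, smul_eq_mul] at hfx hfy
  obtain rfl : a = 1 - b := by linarith
  have hxy : f x = f y := by
    apply le_antisymm <;> nlinarith
  have hx' : x ∈ maximizers (convexHull ℝ A) f := by
    refine ⟨hx, fun z hz => (huf.2 z hz).trans (le_of_eq ?_)⟩
    simp only [map_add, map_smul, smul_eq_mul, hxy]; ring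
  have hy' : y ∈ maximizers (convexHull ℝ A) f :=
    ⟨hy, fun z hz => (hx'.2 z hz).trans hxy.le⟩
  rw [hf, segment_eq_image'] at hx' hy'
  set u := (1 - b) • x + b • y with hu_def
  obtain ⟨p, hp, hpx⟩ := hx'
  obtain ⟨q, hq, hqy⟩ := hy'
  have hd : v - u ≠ 0 := sub_ne_zero.2 hvu
  have key : ((1 - b) * p + b * q) • (v - u) = 0 := by
    have : (1 - b) • (u + p • (v - u)) + b • (u + q • (v - u)) = u := by
      simp only at hpx hqy
      rw [hpx, hqy]
    have h2 : ((1 - b) * p + b * q) • (v - u)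
        = (1 - b) • (u + p • (v - u)) + b • (u + q • (v - u)) - u := by module
    rw [h2, this, sub_self]
  have h0 := (smul_eq_zero.1 key).resolve_right hd
  have hp0 : p = 0 := by
    have := mul_nonneg ha.le hp.1
    have := mul_nonneg hb.le hq.1
    have : (1 - b) * p = 0 := by linarith
    exact (mul_eq_zero.1 this).resolve_left ha.ne'
  simp only [hp0, zero_smul, add_zero] at hpx
  exact hpx.symm

section MinkowskiSum

variable {ι : Type*} [Fintype ι] {S : ι → Set E}

lemma mem_maximizers_of_sum {f : E →ₗ[ℝ] ℝ} {g : ι → E} (hg : ∀ i, g i ∈ S i)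
    (h : ∑ i, g i ∈ maximizers (∑ i, S i) f) (i : ι) : g i ∈ maximizers (S i) f := by
  refine ⟨hg i, fun y hy => ?_⟩
  have := h.2 _ (sum_sub_add_mem_sum hg hy)
  rw [map_add, map_sub] at this
  linarith

lemma sum_sub_add_mem_maximizers {f : E →ₗ[ℝ] ℝ} {g : ι → E} (hg : ∀ i, g i ∈ S i)
    (h : ∑ i, g i ∈ maximizers (∑ i, S i) f) {i : ι} {x : E} (hx : x ∈ maximizers (S i) f) :
    ∑ j, g j - g i + x ∈ maximizers (∑ i, S i) f := by
  refine ⟨sum_sub_add_mem_sum hg hx.1, fun y hy => (h.2 y hy).trans ?_⟩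
  have := hx.2 _ (hg i)
  rw [map_add, map_sub]
  linarith

/-- A maximizer of `f` over a summand differs from a given one by a fraction of the edge. -/
lemma exists_smul_of_mem_maximizers {f : E →ₗ[ℝ] ℝ} {g : ι → E} {v : E} (hg : ∀ i, g i ∈ S i)
    (hf : maximizers (∑ i, S i) f = segment ℝ (∑ i, g i) v) {i : ι} {x : E}
    (hx : x ∈ maximizers (S i) f) :
    ∃ t ∈ Set.Icc (0 : ℝ) 1, x - g i = t • (v - ∑ j, g j) := by
  have h := sum_sub_add_mem_maximizers hg (hf.symm.subset (left_mem_segment ℝ _ _)) hx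
  rw [hf, segment_eq_image'] at h
  obtain ⟨t, ht, h⟩ := h
  refine ⟨t, ht, ?_⟩
  simp only at h
  rw [← add_right_inj (∑ j, g j), h]
  abel

lemma maximizers_eq_segment_of_sum {f : E →ₗ[ℝ] ℝ} {g h : ι → E} (hg : ∀ i, g i ∈ S i)
    (hh : ∀ i, h i ∈ S i)
    (hf : maximizers (∑ i, S i) f = segment ℝ (∑ i, g i) (∑ i, h i)) (hS : ∀ i, Convex ℝ (S i))
    (i : ι) : maximizers (S i) f = segment ℝ (g i) (h i) := by
  have hgi := mem_maximizers_of_sum hg (hf.symm.subset (left_mem_segment ℝ _ _)) i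
  have hhi := mem_maximizers_of_sum hh (hf.symm.subset (right_mem_segment ℝ _ _)) i
  have hgh : f (g i) = f (h i) := le_antisymm (hhi.2 _ hgi.1) (hgi.2 _ hhi.1)
  refine Set.Subset.antisymm (fun x hx => ?_) (fun x hx => ?_)
  · obtain ⟨t, ht, hxt⟩ := exists_smul_of_mem_maximizers hg hf hx
    obtain ⟨r, hr, hxr⟩ := exists_smul_of_mem_maximizers hh (hf.trans (segment_symm ℝ _ _)) hx
    set d := ∑ i, h i - ∑ i, g i with hd
    have hxr' : x - h i = -(r • d) := by rw [hxr, hd]; module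
    have hdiff : h i - g i = (t + r) • d := by
      have : h i - g i = (x - g i) - (x - h i) := by abel
      rw [this, hxt, hxr']; module
    have hx' : x = g i + t • d := by rw [← hxt]; abel
    rcases (add_nonneg ht.1 hr.1).eq_or_lt with h0 | h0
    · have ht0 : t = 0 := by linarith [ht.1, hr.1]
      rw [hx', ht0, zero_smul, add_zero]
      exact left_mem_segment ℝ _ _
    · rw [segment_eq_image']
      refine ⟨t / (t + r), ⟨div_nonneg ht.1 h0.le, ?_⟩, ?_⟩
      · rw [div_le_one h0]; linarith [hr.1]
      · simp only
        rw [hdiff, smul_smul, div_mul_cancel₀ _ h0.ne', hx']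
  · refine ⟨(hS i).segment_subset hgi.1 hhi.1 hx, fun y hy => (hgi.2 y hy).trans (le_of_eq ?_)⟩
    obtain ⟨a, b, ha, hb, hab, rfl⟩ := hx
    simp only [map_add, map_smul, smul_eq_mul, ← hgh]
    rw [← add_mul, hab, one_mul]

/-- Some summand of a Minkowski sum with an edge clique on at least three points
has an edge clique of the same size. -/
lemma IsEdgeClique.exists_summand {s : Finset E} (hs : IsEdgeClique (∑ i, S i) s)
    (hS : ∀ i, Convex ℝ (S i)) (h3 : 3 ≤ s.card) :
    ∃ i, ∃ t : Finset E, t.card = s.card ∧ IsEdgeClique (S i) t := by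
  classical
  have hsub := hs.subset (by omega)
  have hdec : ∀ u, ∃ g : ι → E, u ∈ s → (∀ i, g i ∈ S i) ∧ ∑ i, g i = u := by
    intro u
    by_cases hu : u ∈ s
    · obtain ⟨g, hg, hgu⟩ := Set.mem_fintype_sum _ _ |>.1 (hsub hu)
      exact ⟨g, fun _ => ⟨hg, hgu⟩⟩
    · exact ⟨0, fun h => absurd h hu⟩
  choose g hg using hdec
  have hratio : ∀ i u v, ∃ c : ℝ, u ∈ s → v ∈ s → u ≠ v → g v i - g u i = c • (v - u) := by
    intro i u v
    by_cases h : u ∈ s ∧ v ∈ s ∧ u ≠ v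
    · obtain ⟨hu, hv, huv⟩ := h
      obtain ⟨f, hf⟩ := hs u hu v hv huv
      have hgv := mem_maximizers_of_sum (hg v hv).1
        (by rw [(hg v hv).2, hf]; exact right_mem_segment ℝ _ _) i
      obtain ⟨c, -, hc⟩ := exists_smul_of_mem_maximizers (hg u hu).1
        (by rw [(hg u hu).2, hf]) hgv
      rw [(hg u hu).2] at hc
      exact ⟨c, fun _ _ _ => hc⟩
    · exact ⟨0, fun hu hv huv => absurd ⟨hu, hv, huv⟩ h⟩
  choose c hc using hratio
  have htri : ∀ i, ∀ u ∈ s, ∀ v ∈ s, ∀ w ∈ s, u ≠ v → u ≠ w → v ≠ w → c i v w = c i u w := by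
    intro i u hu v hv w hw huv huw hvw
    obtain ⟨f, hf⟩ := hs u hu v hv huv
    have huf := hf.symm.subset (left_mem_segment ℝ u v)
    have hvf := hf.symm.subset (right_mem_segment ℝ u v)
    have hfuv : f u = f v := le_antisymm (hvf.2 _ huf.1) (huf.2 _ hvf.1)
    have hfw : f w ≠ f v := by
      intro h
      refine hs.notMem_segment hu hv hw huw hvw (hf.subset ⟨hsub hw, fun y hy => ?_⟩)
      exact h ▸ hvf.2 y hy
    have h1 := congrArg f (hc i u v hu hv huv)
    have h2 := congrArg f (hc i v w hv hw hvw)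
    have h3 := congrArg f (hc i u w hu hw huw)
    simp only [map_sub, map_smul, smul_eq_mul, hfuv, sub_self, mul_zero] at h1 h2 h3
    refine mul_right_cancel₀ (sub_ne_zero.2 hfw) ?_
    linarith
  have hsymm : ∀ i, ∀ u ∈ s, ∀ v ∈ s, u ≠ v → c i u v = c i v u := by
    intro i u hu v hv huv
    have h1 := hc i u v hu hv huv
    have h2 := hc i v u hv hu huv.symm
    refine smul_left_injective ℝ (sub_ne_zero.2 huv.symm) ?_
    simp only
    rw [← h1, ← neg_sub (g u i), h2]
    module
  obtain ⟨a, ha, b, hb, hab⟩ := Finset.one_lt_card.1 (show 1 < s.card by omega)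
  have hconst : ∀ i, ∀ u ∈ s, ∀ v ∈ s, u ≠ v → c i u v = c i a b := by
    have hto : ∀ i, ∀ u ∈ s, ∀ v ∈ s, ∀ w ∈ s, u ≠ w → v ≠ w → c i v w = c i u w := by
      intro i u hu v hv w hw huw hvw
      rcases eq_or_ne u v with rfl | huv
      · rfl
      · exact htri i u hu v hv w hw huv huw hvw
    intro i u hu v hv huv
    rcases eq_or_ne v b with rfl | hvb
    · exact hto i a ha u hu v hv hab huv
    · rw [hto i b hb u hu v hv hvb.symm huv, hsymm i b hb v hv hvb.symm,
        hto i a ha v hv b hb hab hvb]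
  obtain ⟨i, hi⟩ : ∃ i, c i a b ≠ 0 := by
    by_contra! h
    apply hab
    rw [← (hg a ha).2, ← (hg b hb).2]
    refine Finset.sum_congr rfl fun i _ => ?_
    have := hc i a b ha hb hab
    rw [h i, zero_smul, sub_eq_zero] at this
    exact this.symm
  refine ⟨i, s.image (fun u => g u i), Finset.card_image_of_injOn ?_, ?_⟩
  · intro u hu v hv huv
    by_contra hne
    have h := hc i u v hu hv hne
    simp only at huv
    rw [hconst i u hu v hv hne, huv, sub_self, eq_comm, smul_eq_zero, sub_eq_zero] at h
    exact h.elim hi fun h => hne h.symm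
  · intro x hx y hy hxy
    obtain ⟨u, hu, rfl⟩ := Finset.mem_image.1 hx
    obtain ⟨v, hv, rfl⟩ := Finset.mem_image.1 hy
    have huv : u ≠ v := fun h => hxy (by rw [h])
    obtain ⟨f, hf⟩ := hs u hu v hv huv
    exact ⟨f, maximizers_eq_segment_of_sum (hg u hu).1 (hg v hv).1
      (by rw [(hg u hu).2, (hg v hv).2, hf]) hS i⟩

end MinkowskiSum

end Clique

lemma convex_of_mem_polyDepth {n m : ℕ} {P : Set (Fin n → ℝ)} (hP : P ∈ PolyDepth n m) :
    Convex ℝ P := by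
  cases m with
  | zero =>
    obtain ⟨a, rfl⟩ := hP
    exact convex_singleton a
  | succ m =>
    obtain ⟨k, Q, R, -, rfl⟩ := hP
    exact convex_sum _ fun i _ => convex_convexHull ℝ _

/-- A polytope of depth `m` has no edge clique on more than `2 ^ m` points. -/
lemma card_le_two_pow_of_mem_polyDepth {n : ℕ} (m : ℕ) :
    ∀ {P : Set (Fin n → ℝ)} {s : Finset (Fin n → ℝ)}, P ∈ PolyDepth n m → IsEdgeClique P s →
      s.card ≤ 2 ^ m := by
  classical
  induction m with
  | zero =>
    rintro P s ⟨a, rfl⟩ hs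
    by_contra! h
    have hsub := hs.subset (by simpa using h)
    have hcard := Finset.card_le_card (t := {a}) (fun x hx => by simpa using hsub hx)
    rw [Finset.card_singleton] at hcard
    simp at h
    omega
  | succ m ih =>
    rintro P s ⟨k, Q, R, hQR, rfl⟩ hs
    rw [pow_succ]
    rcases Nat.lt_or_ge s.card 3 with h3 | h3
    · have := Nat.one_le_two_pow (n := m)
      omega
    obtain ⟨i, t, hcard, ht⟩ := hs.exists_summand (fun i => convex_convexHull ℝ _) h3
    have htsub := ht.subset_of_convexHull (by omega)
    have hQ := ih (hQR i).1 (ht.mono_of_convex (t := t.filter (· ∈ Q i))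
      (convex_of_mem_polyDepth (hQR i).1)
      (Set.subset_union_left.trans (subset_convexHull ℝ _)) (Finset.filter_subset _ _)
      (fun x hx => (Finset.mem_filter.1 hx).2))
    have hR := ih (hQR i).2 (ht.mono_of_convex (t := t.filter (· ∈ R i))
      (convex_of_mem_polyDepth (hQR i).2)
      (Set.subset_union_right.trans (subset_convexHull ℝ _)) (Finset.filter_subset _ _)
      (fun x hx => (Finset.mem_filter.1 hx).2))
    have hunion : t ⊆ t.filter (· ∈ Q i) ∪ t.filter (· ∈ R i) := by
      intro x hx
      rw [← Finset.filter_or]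
      exact Finset.mem_filter.2 ⟨hx, htsub hx⟩
    have := (Finset.card_le_card hunion).trans (Finset.card_union_le _ _)
    omega

lemma IsFace.exists_maximizers_eq {n : ℕ} {P F : Set (Fin n → ℝ)} (hF : IsFace n P F) :
    ∃ f : (Fin n → ℝ) →ₗ[ℝ] ℝ, maximizers P f = F := by
  rcases hF with rfl | ⟨c, rfl⟩
  · exact ⟨0, by simp [maximizers]⟩
  · exact ⟨∑ i, c i • LinearMap.proj i, by simp [maximizers]⟩

/-- If the graph of a polytope `P ⊂ ℝⁿ` contains a complete subgraph on
`p ≥ 3` vertices (p distinct vertices of `P`, each pair joined by an edge of `P`), then the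
minimal depth `m` of `P` satisfies `m ≥ ⌈log₂ p⌉`; equivalently `P ∉ Δₙ(⌈log₂ p⌉ - 1)`. -/
theorem statement19 (n p : ℕ) (hp : 3 ≤ p) (P : Set (Fin n → ℝ))
    (hP : IsPolytope n P) (v : Fin p → Fin n → ℝ) (hv : Function.Injective v)
    (hvert : ∀ i, IsFace n P {v i})
    (hedge : ∀ i j, i ≠ j → IsFace n P (segment ℝ (v i) (v j))) :
    (∀ m, PolyMinDepth n P m → Nat.clog 2 p ≤ m) ∧
    P ∉ PolyDepth n (Nat.clog 2 p - 1) := by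
  classical
  have hclique : IsEdgeClique P (Finset.univ.image v) := by
    intro x hx y hy hxy
    obtain ⟨i, -, rfl⟩ := Finset.mem_image.1 hx
    obtain ⟨j, -, rfl⟩ := Finset.mem_image.1 hy
    exact (hedge i j fun h => hxy (by rw [h])).exists_maximizers_eq
  have hbound : ∀ m, P ∈ PolyDepth n m → Nat.clog 2 p ≤ m := by
    intro m hm
    have := card_le_two_pow_of_mem_polyDepth m hm hclique
    rw [Finset.card_image_of_injective _ hv, Finset.card_univ, Fintype.card_fin] at this
    exact Nat.clog_le_of_le_pow this
  refine ⟨fun m hm => hbound m hm.1, fun h => ?_⟩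
  have h1 := hbound _ h
  have h2 : 0 < Nat.clog 2 p := Nat.clog_pos (by norm_num) (by omega)
  omega
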